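/- Preservation of deadlock-freeness: if the communicating systems S1 and S2 are both deadlock-free, then the composed system S = S1 ⋈_{H,K} S2 is deadlock-free. -/

import Mathlib

/- Common formalization of Communicating Finite State Machines (CFSMs),
communicating systems, gateways and their composition, following
"Global Types with Internal Delegation" / GTIR paper definitions. -/

namespace GTIR

/-- Polarity of an action: `!` (send) or `?` (receive). -/
inductive Pol : Type
  | bang
  | query
deriving DecidableEq

/-- Dual polarity: swap `!` and `?`. -/
def Pol.dual : Pol → Pol
  | .bang => .query
  | .query => .bang

/-- Actions over roles `R` and messages `A`:
`snd s r a` is `sr!a` (s sends `a` to r), `rcv s r a` is `sr?a`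
(r receives/consumes `a` sent by s). -/
inductive Act (R A : Type) : Type
  | snd : R → R → A → Act R A
  | rcv : R → R → A → Act R A

/-- The action is a send action. -/
def Act.isSend {R A : Type} : Act R A → Prop
  | .snd _ _ _ => True
  | .rcv _ _ _ => False

/-- The action is a receive action. -/
def Act.isRecv {R A : Type} : Act R A → Prop
  | .snd _ _ _ => False
  | .rcv _ _ _ => True

/-- Erase the channel name of an action: `pq!a ↦ !a`, `pq?a ↦ ?a`. -/
def Act.noC {R A : Type} : Act R A → Pol × A
  | .snd _ _ a => (.bang, a)
  | .rcv _ _ a => (.query, a)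

/-- The dual of a word over `{!,?} × A`: swap `!` and `?` pointwise. -/
def dualWord {A : Type} (w : List (Pol × A)) : List (Pol × A) :=
  w.map fun x => (x.1.dual, x.2)

/-- Universal state type: base states from `B`, plus arbitrarily nested fresh
"hat" states (one for each transition) used by the gateway construction. -/
inductive St (R A B : Type) : Type
  | base : B → St R A B
  | hat : St R A B → Act R A → St R A B → St R A B

/-- A communicating finite state machine over roles `R` and messages `A`,
with states taken from `St R A B`: an initial state together with a
transition relation. -/
structure CFSM (R A B : Type) where
  init : St R A B
  delta : Set (St R A B × Act R A × St R A B)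

namespace CFSM

variable {R A B : Type}

/-- A state is final if it has no outgoing transition. -/
def Final (M : CFSM R A B) (q : St R A B) : Prop :=
  ∀ l q', (q, l, q') ∉ M.delta

/-- A sending state: non-final, and all outgoing transitions are sends. -/
def Sending (M : CFSM R A B) (q : St R A B) : Prop :=
  (∃ l q', (q, l, q') ∈ M.delta) ∧ ∀ l q', (q, l, q') ∈ M.delta → l.isSend

/-- A receiving state: non-final, and all outgoing transitions are receives. -/
def Receiving (M : CFSM R A B) (q : St R A B) : Prop :=
  (∃ l q', (q, l, q') ∈ M.delta) ∧ ∀ l q', (q, l, q') ∈ M.delta → l.isRecv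

/-- A mixed state: it has both an outgoing send and an outgoing receive. -/
def Mixed (M : CFSM R A B) (q : St R A B) : Prop :=
  (∃ l q', (q, l, q') ∈ M.delta ∧ l.isSend) ∧
  (∃ l q', (q, l, q') ∈ M.delta ∧ l.isRecv)

/-- `M` has no mixed states. -/
def NoMixed (M : CFSM R A B) : Prop := ∀ q, ¬ M.Mixed q

/-- `?`-determinism: two receives of the same message from the same state
(possibly on different channels) have the same target. -/
def QDet (M : CFSM R A B) : Prop :=
  ∀ q a s r s' r' q' q'', (q, Act.rcv s r a, q') ∈ M.delta →
    (q, Act.rcv s' r' a, q'') ∈ M.delta → q' = q''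

/-- `!`-determinism: two sends of the same message from the same state
(possibly on different channels) have the same target. -/
def BDet (M : CFSM R A B) : Prop :=
  ∀ q a s r s' r' q' q'', (q, Act.snd s r a, q') ∈ M.delta →
    (q, Act.snd s' r' a, q'') ∈ M.delta → q' = q''

/-- `?!`-determinism. -/
def IODet (M : CFSM R A B) : Prop := M.QDet ∧ M.BDet

/-- Accepting runs from a given state (every state is accepting). -/
inductive Accepts (M : CFSM R A B) : St R A B → List (Act R A) → Prop
  | nil (q : St R A B) : Accepts M q []
  | cons {q : St R A B} {l : Act R A} {q' : St R A B} {φ : List (Act R A)} :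
      (q, l, q') ∈ M.delta → Accepts M q' φ → Accepts M q (l :: φ)

/-- The language of `M` over `Act`. -/
def lang (M : CFSM R A B) : Set (List (Act R A)) := {φ | M.Accepts M.init φ}

/-- The language of `M` with channel names erased. -/
def langNoC (M : CFSM R A B) : Set (List (Pol × A)) :=
  (fun φ => φ.map Act.noC) '' M.lang

/-- Compatibility `M ↔ M'`: the channel-erased language of `M` is the set of
duals of the channel-erased language of `M'`; moreover neither machine has a
mixed state and both are `?!`-deterministic. -/
def Compat (M M' : CFSM R A B) : Prop :=
  M.langNoC = dualWord '' M'.langNoC ∧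
  M.NoMixed ∧ M'.NoMixed ∧ M.IODet ∧ M'.IODet

/-- The machine of role `p` over the role set `P`: every transition label is
an action of `p` (a send `pr!a` or a receive `rp?a`) with partner `r ∈ P`. -/
def ActsFor (M : CFSM R A B) (p : R) (P : Set R) : Prop :=
  ∀ q l q', (q, l, q') ∈ M.delta →
    ∃ r a, r ∈ P ∧ r ≠ p ∧ (l = Act.snd p r a ∨ l = Act.rcv r p a)

/-- All states occurring in `M` are base states; this guarantees that the
intermediate "hat" states of the gateway construction are fresh for `M`. -/
def HatFree (M : CFSM R A B) : Prop :=
  (∃ b, M.init = St.base b) ∧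
  ∀ q l q', (q, l, q') ∈ M.delta →
    (∃ b, q = St.base b) ∧ (∃ b, q' = St.base b)

/-- The set `Q̂` of fresh intermediate gateway states of `M`
(one for each transition of `M`). -/
def hatStates (M : CFSM R A B) : Set (St R A B) :=
  {x | ∃ q l q', (q, l, q') ∈ M.delta ∧ x = St.hat q l q'}

/-- The gateway `gw(M_H, K)` of the machine `M` of role `H` towards role `K`:
each transition `t = (q, Hs!a, q')` of `M` is replaced by
`(q, KH?a, q̂_t)` and `(q̂_t, Hs!a, q')`, and each transition
`t = (q, sH?a, q')` of `M` is replaced by `(q, sH?a, q̂_t)` and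
`(q̂_t, HK!a, q')`. -/
def gw (M : CFSM R A B) (H K : R) : CFSM R A B where
  init := M.init
  delta :=
    {x | ∃ q s a q', (q, Act.snd H s a, q') ∈ M.delta ∧
      (x = (q, Act.rcv K H a, St.hat q (Act.snd H s a) q') ∨
       x = (St.hat q (Act.snd H s a) q', Act.snd H s a, q'))} ∪
    {x | ∃ q s a q', (q, Act.rcv s H a, q') ∈ M.delta ∧
      (x = (q, Act.rcv s H a, St.hat q (Act.rcv s H a) q') ∨
       x = (St.hat q (Act.rcv s H a) q', Act.snd H K a, q'))}

end CFSM

/-- A communicating system: a set of roles together with a CFSM for each role. -/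
structure CS (R A B : Type) where
  roles : Set R
  mach : R → CFSM R A B

namespace CS

variable {R A B : Type}

/-- Well-formedness: the machine of each role `p` of the system only carries
actions of `p` with partners among the system's roles. -/
def WF (S : CS R A B) : Prop :=
  ∀ p ∈ S.roles, (S.mach p).ActsFor p S.roles

/-- Each machine of the system has a finite transition relation
(hence finitely many relevant states). -/
def FiniteSys (S : CS R A B) : Prop :=
  ∀ p ∈ S.roles, (S.mach p).delta.Finite

open scoped Classical in
/-- Composition `S1 ⋈_{H,K} S2`: the union of the two systems, where the
machines of the interface roles `H` and `K` are replaced by the gateways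
`gw(M¹_H, K)` and `gw(M²_K, H)`. -/
noncomputable def compose (S1 S2 : CS R A B) (H K : R) : CS R A B where
  roles := S1.roles ∪ S2.roles
  mach := fun p =>
    if p = H then (S1.mach H).gw H K
    else if p = K then (S2.mach K).gw K H
    else if p ∈ S1.roles then S1.mach p
    else S2.mach p

end CS

/-- A configuration: a local state for every role and a buffer (word over the
messages) for every ordered channel. -/
structure Config (R A B : Type) where
  st : R → St R A B
  buf : R → R → List A

/-- The initial configuration(s) of a system: every machine of the system is
in its initial state and all the system's buffers are empty. -/
def InitConf {R A B : Type} (S : CS R A B) (c : Config R A B) : Prop :=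
  (∀ p ∈ S.roles, c.st p = (S.mach p).init) ∧
  (∀ p ∈ S.roles, ∀ q ∈ S.roles, c.buf p q = [])

/-- One asynchronous step of system `S`, labelled by an action:
a send `sr!a` appends `a` to the buffer of channel `sr`, a receive `sr?a`
removes `a` from the front of the buffer of channel `sr`; everything else is
unchanged. -/
def Step {R A B : Type} (S : CS R A B) (c : Config R A B) :
    Act R A → Config R A B → Prop
  | .snd s r a, c' =>
      s ∈ S.roles ∧ (c.st s, Act.snd s r a, c'.st s) ∈ (S.mach s).delta ∧
      (∀ p, p ≠ s → c'.st p = c.st p) ∧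
      c'.buf s r = c.buf s r ++ [a] ∧
      (∀ p q, ¬(p = s ∧ q = r) → c'.buf p q = c.buf p q)
  | .rcv s r a, c' =>
      r ∈ S.roles ∧ (c.st r, Act.rcv s r a, c'.st r) ∈ (S.mach r).delta ∧
      (∀ p, p ≠ r → c'.st p = c.st p) ∧
      c.buf s r = a :: c'.buf s r ∧
      (∀ p q, ¬(p = s ∧ q = r) → c'.buf p q = c.buf p q)

/-- `RS(S)`: the configurations reachable from the initial configuration. -/
def Reach {R A B : Type} (S : CS R A B) (c : Config R A B) : Prop :=
  ∃ c₀, InitConf S c₀ ∧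
    Relation.ReflTransGen (fun x y => ∃ l, Step S x l y) c₀ c

/-- Deadlock configuration: all the system's buffers are empty and every
machine is in a receiving state. -/
def DeadlockConf {R A B : Type} (S : CS R A B) (c : Config R A B) : Prop :=
  (∀ p ∈ S.roles, ∀ q ∈ S.roles, c.buf p q = []) ∧
  ∀ p ∈ S.roles, (S.mach p).Receiving (c.st p)

/-- A system is deadlock-free if no reachable configuration is a deadlock. -/
def DeadlockFree {R A B : Type} (S : CS R A B) : Prop :=
  ∀ c, Reach S c → ¬ DeadlockConf S c

/-- Orphan-message configuration: every machine is in a final state but some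
buffer of the system is non-empty. -/
def OrphanConf {R A B : Type} (S : CS R A B) (c : Config R A B) : Prop :=
  (∀ p ∈ S.roles, (S.mach p).Final (c.st p)) ∧
  ∃ p ∈ S.roles, ∃ q ∈ S.roles, c.buf p q ≠ []

/-- Unspecified reception configuration: some machine is in a receiving state
but each of its expected input buffers is non-empty and starts with a message
it cannot receive. -/
def UnspecConf {R A B : Type} (S : CS R A B) (c : Config R A B) : Prop :=
  ∃ r ∈ S.roles, (S.mach r).Receiving (c.st r) ∧
    ∀ s a q', (c.st r, Act.rcv s r a, q') ∈ (S.mach r).delta →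
      c.buf s r ≠ [] ∧ ∀ w, c.buf s r ≠ a :: w

/-- A system is safe if no reachable configuration is a deadlock,
an orphan-message, or an unspecified reception configuration. -/
def Safe {R A B : Type} (S : CS R A B) : Prop :=
  ∀ c, Reach S c →
    ¬ DeadlockConf S c ∧ ¬ OrphanConf S c ∧ ¬ UnspecConf S c

end GTIR

open GTIR

namespace GTIR
variable {R A B : Type}

inductive Path (M : CFSM R A B) : St R A B → List (Pol × A) → St R A B → Prop
  | nil (q : St R A B) : Path M q [] q
  | cons {q l q' w q''} : (q, l, q') ∈ M.delta → Path M q' w q'' → Path M q (l.noC :: w) q''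

def qs : List (Pol × A) → List A
  | [] => []
  | (.query, a) :: w => a :: qs w
  | (.bang, _) :: w => qs w

def bs : List (Pol × A) → List A
  | [] => []
  | (.query, _) :: w => bs w
  | (.bang, a) :: w => a :: bs w

theorem qs_append (u v : List (Pol × A)) : qs (u ++ v) = qs u ++ qs v := by
  induction u with
  | nil => rfl
  | cons x u ih => obtain ⟨_ | _, a⟩ := x <;> simp [qs, ih]

theorem bs_append (u v : List (Pol × A)) : bs (u ++ v) = bs u ++ bs v := by
  induction u with
  | nil => rfl
  | cons x u ih => obtain ⟨_ | _, a⟩ := x <;> simp [bs, ih]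

theorem Path.snoc {M : CFSM R A B} {q w q' l q''} (h : Path M q w q')
    (h2 : (q', l, q'') ∈ M.delta) : Path M q (w ++ [l.noC]) q'' := by
  induction h with
  | nil q => exact .cons h2 (.nil _)
  | cons h1 _ ih => exact .cons h1 (ih h2)

theorem path_accepts {M : CFSM R A B} {q w q'} (h : Path M q w q') :
    ∃ φ, M.Accepts q φ ∧ φ.map Act.noC = w := by
  induction h with
  | nil q => exact ⟨[], .nil _, rfl⟩
  | cons h1 _ ih =>
    obtain ⟨φ, h, rfl⟩ := ih
    exact ⟨_ :: φ, .cons h1 h, rfl⟩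

theorem accepts_path {M : CFSM R A B} {q φ} (h : M.Accepts q φ) :
    ∃ q', Path M q (φ.map Act.noC) q' := by
  induction h with
  | nil q => exact ⟨q, .nil q⟩
  | cons h1 _ ih =>
    obtain ⟨q', h⟩ := ih
    exact ⟨q', .cons h1 h⟩

theorem mem_langNoC (M : CFSM R A B) (w) : w ∈ M.langNoC ↔ ∃ q', Path M M.init w q' := by
  constructor
  · rintro ⟨φ, h, rfl⟩
    exact accepts_path h
  · rintro ⟨q', h⟩
    obtain ⟨φ, hφ, rfl⟩ := path_accepts h
    exact ⟨φ, hφ, rfl⟩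

theorem dualWord_dualWord (w : List (Pol × A)) : dualWord (dualWord w) = w := by
  induction w with
  | nil => rfl
  | cons x w ih =>
    obtain ⟨_ | _, a⟩ := x <;> simpa [dualWord, Pol.dual] using ih

theorem det {M : CFSM R A B} (h : M.IODet) {q l q' l' q''} (h1 : (q, l, q') ∈ M.delta)
    (h2 : (q, l', q'') ∈ M.delta) (e : l.noC = l'.noC) : q' = q'' := by
  rcases l with ⟨s, r, a⟩ | ⟨s, r, a⟩ <;> rcases l' with ⟨s', r', a'⟩ | ⟨s', r', a'⟩ <;>
    simp [Act.noC] at e <;> subst e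
  · exact h.2 _ _ _ _ _ _ _ _ h1 h2
  · exact h.1 _ _ _ _ _ _ _ _ h1 h2

/-- dual residual languages -/
def DR (M N : CFSM R A B) (q k : St R A B) : Prop :=
  ∀ w, (∃ q', Path M q w q') ↔ ∃ k', Path N k (dualWord w) k'

theorem DR.step {M N : CFSM R A B} (hM : M.IODet) (hN : N.IODet) {q k l q' m k'}
    (h : DR M N q k) (h1 : (q, l, q') ∈ M.delta) (h2 : (k, m, k') ∈ N.delta)
    (e : m.noC = (l.noC.1.dual, l.noC.2)) : DR M N q' k' := by
  intro w
  have := h (l.noC :: w)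
  have e2 : dualWord (l.noC :: w) = m.noC :: dualWord w := by rw [e]; rfl
  rw [e2] at this
  constructor
  · rintro ⟨p, hp⟩
    obtain ⟨z, hz⟩ := this.1 ⟨p, .cons h1 hp⟩
    generalize hv : m.noC :: dualWord w = v at hz
    cases hz with
    | nil => simp at hv
    | cons ha hb =>
      simp only [List.cons.injEq] at hv
      obtain ⟨hv1, rfl⟩ := hv
      obtain rfl := det hN h2 ha hv1
      exact ⟨_, hb⟩
  · rintro ⟨p, hp⟩
    obtain ⟨z, hz⟩ := this.2 ⟨p, .cons h2 hp⟩
    generalize hv : l.noC :: w = v at hz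
    cases hz with
    | nil => simp at hv
    | cons ha hb =>
      simp only [List.cons.injEq] at hv
      obtain ⟨hv1, rfl⟩ := hv
      obtain rfl := det hM h1 ha hv1
      exact ⟨_, hb⟩

theorem DR.next {M N : CFSM R A B} {q k l q'} (h : DR M N q k) (h1 : (q, l, q') ∈ M.delta) :
    ∃ m k', (k, m, k') ∈ N.delta ∧ m.noC = (l.noC.1.dual, l.noC.2) := by
  obtain ⟨z, hz⟩ := (h [l.noC]).1 ⟨q', .cons h1 (.nil _)⟩
  generalize hv : dualWord [l.noC] = v at hz
  cases hz with
  | nil => simp [dualWord] at hv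
  | cons ha hb =>
    simp only [dualWord, List.map_cons, List.cons.injEq] at hv
    exact ⟨_, _, ha, hv.1.symm⟩

theorem DR.path {M N : CFSM R A B} (hM : M.IODet) (hN : N.IODet) (hmx : N.NoMixed)
    {q k w q' v k'} (h : DR M N q k) (h1 : Path M q w q') (h2 : Path N k v k')
    (e1 : qs w = bs v) (e2 : bs w = qs v) : DR M N q' k' := by
  induction h1 generalizing k v with
  | nil q =>
    cases h2 with
    | nil => exact h
    | cons ha hb =>
      rename_i l _ _
      rcases l with ⟨s, r, a⟩ | ⟨s, r, a⟩ <;> simp [Act.noC, qs, bs] at e1 e2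
  | cons ha hb ih =>
    rename_i l _ _ _
    cases h2 with
    | nil => rcases l with ⟨s, r, a⟩ | ⟨s, r, a⟩ <;> simp [Act.noC, qs, bs] at e1 e2
    | cons hc hd =>
      rename_i m _ _
      obtain ⟨m', k₂, hn, en⟩ := h.next ha
      rcases l with ⟨s, r, a⟩ | ⟨s, r, a⟩ <;> rcases m with ⟨s', r', a'⟩ | ⟨s', r', a'⟩
      · rcases m' with ⟨s'', r'', a''⟩ | ⟨s'', r'', a''⟩
        · simp [Act.noC, Pol.dual] at en
        · exact absurd ⟨⟨_, _, hc, trivial⟩, ⟨_, _, hn, trivial⟩⟩ (hmx k)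
      · simp [Act.noC, qs, bs] at e1 e2
        obtain ⟨rfl, e2⟩ := e2
        exact ih (h.step hM hN ha hc rfl) hd e1 e2
      · simp [Act.noC, qs, bs] at e1 e2
        obtain ⟨rfl, e1⟩ := e1
        exact ih (h.step hM hN ha hc rfl) hd e1 e2
      · rcases m' with ⟨s'', r'', a''⟩ | ⟨s'', r'', a''⟩
        · exact absurd ⟨⟨_, _, hn, trivial⟩, ⟨_, _, hc, trivial⟩⟩ (hmx k)
        · simp [Act.noC, Pol.dual] at en

theorem DR.init {M N : CFSM R A B} (h : M.langNoC = dualWord '' N.langNoC) :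
    DR M N M.init N.init := by
  intro w
  rw [← mem_langNoC, ← mem_langNoC, h]
  constructor
  · rintro ⟨v, hv, rfl⟩
    rwa [dualWord_dualWord]
  · intro hw
    exact ⟨_, hw, dualWord_dualWord w⟩

/-- gateway bookkeeping -/
inductive G (M : CFSM R A B) : St R A B → List A → List A → Prop
  | stay {w q} : Path M M.init w q → G M q (qs w) (bs w)
  | hs {w q s r a q'} : Path M M.init w q → (q, Act.snd s r a, q') ∈ M.delta →
      G M (.hat q (.snd s r a) q') (qs w) (bs w ++ [a])
  | hr {w q s r a q'} : Path M M.init w q → (q, Act.rcv s r a, q') ∈ M.delta →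
      G M (.hat q (.rcv s r a) q') (qs w) (bs w)

theorem path_base {M : CFSM R A B} (hf : M.HatFree) {q w q'} (h : Path M q w q')
    (hq : ∃ b, q = .base b) : ∃ b, q' = .base b := by
  induction h with
  | nil => exact hq
  | cons h1 _ ih => exact ih (hf.2 _ _ _ h1).2

theorem G_snd {M : CFSM R A B} {H K : R} {P : Set R} (hA : M.ActsFor H P) (hK : K ∉ P)
    (hf : M.HatFree) {σ x y r a σ'} (hG : G M σ x y)
    (h : (σ, Act.snd H r a, σ') ∈ (M.gw H K).delta) :
    (r ≠ K ∧ G M σ' x y) ∨ (r = K ∧ G M σ' (x ++ [a]) y) := by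
  rcases h with ⟨q, s, b, q', hd, h | h⟩ | ⟨q, s, b, q', hd, h | h⟩
  · simp at h
  · simp only [Prod.mk.injEq, Act.snd.injEq, true_and] at h
    obtain ⟨rfl, ⟨rfl, rfl⟩, rfl⟩ := h
    left
    refine ⟨?_, ?_⟩
    · rintro rfl
      obtain ⟨r', a', h1, h2, h3⟩ := hA _ _ _ hd
      simp at h3
      exact hK (h3.1 ▸ h1)
    · cases hG with
      | stay hp => obtain ⟨b, hb⟩ := path_base hf hp hf.1; cases hb
      | hs hp _ =>
        have := G.stay (hp.snoc hd)
        simpa [qs_append, bs_append, Act.noC, qs, bs] using this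
  · simp at h
  · simp only [Prod.mk.injEq, Act.snd.injEq, true_and] at h
    obtain ⟨rfl, ⟨rfl, rfl⟩, rfl⟩ := h
    right
    refine ⟨rfl, ?_⟩
    cases hG with
    | stay hp => obtain ⟨b, hb⟩ := path_base hf hp hf.1; cases hb
    | hr hp _ =>
      have := G.stay (hp.snoc hd)
      simpa [qs_append, bs_append, Act.noC, qs, bs] using this

theorem G_rcv {M : CFSM R A B} {H K : R} {P : Set R} (hA : M.ActsFor H P) (hK : K ∉ P)
    (hf : M.HatFree) {σ x y s a σ'} (hG : G M σ x y)
    (h : (σ, Act.rcv s H a, σ') ∈ (M.gw H K).delta) :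
    (s ≠ K ∧ G M σ' x y) ∨ (s = K ∧ G M σ' x (y ++ [a])) := by
  rcases h with ⟨q, s, b, q', hd, h | h⟩ | ⟨q, s, b, q', hd, h | h⟩
  · simp only [Prod.mk.injEq, Act.rcv.injEq, true_and] at h
    obtain ⟨rfl, ⟨rfl, rfl⟩, rfl⟩ := h
    right
    refine ⟨rfl, ?_⟩
    obtain ⟨b, hb⟩ := (hf.2 _ _ _ hd).1
    cases hG with
    | stay hp => exact .hs hp hd
    | hs hp _ => cases hb
    | hr hp _ => cases hb
  · simp at h
  · simp only [Prod.mk.injEq, Act.rcv.injEq, true_and] at h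
    obtain ⟨rfl, ⟨rfl, rfl⟩, rfl⟩ := h
    left
    refine ⟨?_, ?_⟩
    · rintro rfl
      obtain ⟨r', a', h1, h2, h3⟩ := hA _ _ _ hd
      simp at h3
      exact hK (h3.1 ▸ h1)
    · obtain ⟨b, hb⟩ := (hf.2 _ _ _ hd).1
      cases hG with
      | stay hp => exact .hr hp hd
      | hs hp _ => cases hb
      | hr hp _ => cases hb
  · simp at h

/-- at a receiving gateway state -/
theorem G_receiving {M : CFSM R A B} {H K : R} {P : Set R} (hA : M.ActsFor H P)
    (hf : M.HatFree) {σ x y} (hG : G M σ x y)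
    (h : (M.gw H K).Receiving σ) :
    ∃ w b, Path M M.init w σ ∧ x = qs w ∧ y = bs w ∧ σ = .base b ∧
      ∃ l q', (σ, l, q') ∈ M.delta := by
  cases hG with
  | stay hp =>
    obtain ⟨b, hb⟩ := path_base hf hp hf.1
    refine ⟨_, b, hp, rfl, rfl, hb, ?_⟩
    obtain ⟨⟨l, q', h⟩, -⟩ := h
    rcases h with ⟨q, s, b, q', hd, h | h⟩ | ⟨q, s, b, q', hd, h | h⟩ <;> cases h
    · exact ⟨_, _, hd⟩
    · cases hb
    · exact ⟨_, _, hd⟩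
    · cases hb
  | hs hp hd =>
    obtain ⟨r', a', h1, h2, h3⟩ := hA _ _ _ hd
    simp at h3
    obtain ⟨rfl, rfl, rfl⟩ := h3
    exact (h.2 (.snd _ _ _) _ (Or.inl ⟨_, _, _, _, hd, Or.inr rfl⟩)).elim
  | hr hp hd =>
    obtain ⟨r', a', h1, h2, h3⟩ := hA _ _ _ hd
    simp at h3
    obtain ⟨rfl, rfl, rfl⟩ := h3
    exact (h.2 (.snd _ _ _) _ (Or.inr ⟨_, _, _, _, hd, Or.inr rfl⟩)).elim

def proj : St R A B → St R A B
  | .base b => .base b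
  | .hat q (.snd _ _ _) _ => q
  | .hat _ (.rcv _ _ _) q' => q'

/-- simulation of the composed system by S1 -/
def Sim (S1 : CS R A B) (H : R) (c : Config R A B) : Prop :=
  ∃ c1, Reach S1 c1 ∧ (∀ p ∈ S1.roles, p ≠ H → c1.st p = c.st p) ∧
    c1.st H = proj (c.st H) ∧
    ∀ p ∈ S1.roles, ∀ q ∈ S1.roles, c1.buf p q = c.buf p q

theorem Reach.step {S : CS R A B} {c l c'} (h : Reach S c) (hs : Step S c l c') : Reach S c' := by
  obtain ⟨c0, hi, hr⟩ := h
  exact ⟨c0, hi, hr.tail ⟨l, hs⟩⟩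

open scoped Classical in
theorem Sim.step {S S1 : CS R A B} {H K : R} (hH : H ∈ S1.roles) (hK : K ∉ S1.roles)
    (hwf : S1.WF) (hf : (S1.mach H).HatFree)
    (hmH : S.mach H = (S1.mach H).gw H K)
    (hm : ∀ p ∈ S1.roles, p ≠ H → S.mach p = S1.mach p)
    {c l c'} (h : Sim S1 H c) (hs : Step S c l c') : Sim S1 H c' := by
  obtain ⟨c1, hR, hst, hstH, hb⟩ := h
  rcases l with ⟨s, r, a⟩ | ⟨s, r, a⟩
  · obtain ⟨h1, h2, h3, h4, h5⟩ := hs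
    by_cases hs1 : s ∈ S1.roles
    · -- real step
      have key : ∀ σ', (c1.st s, Act.snd s r a, σ') ∈ (S1.mach s).delta →
          σ' = (if s = H then proj (c'.st H) else c'.st s) → Sim S1 H c' := by
        intro σ' hd hσ
        have hr : r ∈ S1.roles := by
          obtain ⟨r', a', e1, e2, e3⟩ := hwf s hs1 _ _ _ hd
          simp at e3
          exact e3.1 ▸ e1
        let c1' : Config R A B := ⟨Function.update c1.st s σ',
          fun p q => if p = s ∧ q = r then c1.buf p q ++ [a] else c1.buf p q⟩
        have hstep : Step S1 c1 (.snd s r a) c1' := by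
          refine ⟨hs1, by simpa [c1'] using hd, ?_, by simp [c1'], ?_⟩
          · intro p hp; simp [c1', hp]
          · intro p q hpq; simp only [c1', if_neg hpq]
        refine ⟨c1', hR.step hstep, ?_, ?_, ?_⟩
        · intro p hp hpH
          by_cases hps : p = s
          · subst hps; simp [c1', hσ, hpH]
          · simp [c1', hps, h3 p hps, hst p hp hpH]
        · by_cases hps : s = H
          · subst hps; simp [c1', hσ]
          · have : H ≠ s := fun h => hps h.symm
            simp [c1', this, h3 H this, hstH]
        · intro p hp q hq
          by_cases hpq : p = s ∧ q = r
          · obtain ⟨rfl, rfl⟩ := hpq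
            simp [c1', h4, hb p hp q hq]
          · simp only [c1', if_neg hpq]; rw [h5 p q hpq, hb p hp q hq]
      by_cases hsH : s = H
      · subst hsH
        rw [hmH] at h2
        rcases h2 with ⟨q, s', b, q', hd, h | h⟩ | ⟨q, s', b, q', hd, h | h⟩
        · simp at h
        · simp only [Prod.mk.injEq, Act.snd.injEq, true_and] at h
          obtain ⟨e1, ⟨rfl, rfl⟩, e2⟩ := h
          obtain ⟨b, hbq⟩ := (hf.2 _ _ _ hd).2
          refine key q' ?_ ?_
          · rw [hstH, e1]; exact hd
          · rw [if_pos rfl, e2, hbq]; rfl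
        · simp at h
        · simp only [Prod.mk.injEq, Act.snd.injEq, true_and] at h
          obtain ⟨e1, ⟨rfl, rfl⟩, e2⟩ := h
          obtain ⟨b, hbq⟩ := (hf.2 _ _ _ hd).2
          refine ⟨c1, hR, ?_, ?_, ?_⟩
          · intro p hp hpH; rw [h3 p hpH, hst p hp hpH]
          · rw [hstH, e1, e2, hbq]; rfl
          · intro p hp q hq
            rw [h5 p q, hb p hp q hq]
            rintro ⟨-, rfl⟩; exact hK hq
      · rw [hm s hs1 hsH] at h2
        exact key _ (by rw [hst s hs1 hsH]; exact h2) (by rw [if_neg hsH])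
    · refine ⟨c1, hR, ?_, ?_, ?_⟩
      · intro p hp hpH; rw [h3 p, hst p hp hpH]; rintro rfl; exact hs1 hp
      · rw [h3 H, hstH]; rintro rfl; exact hs1 hH
      · intro p hp q hq
        rw [h5 p q, hb p hp q hq]
        rintro ⟨rfl, -⟩; exact hs1 hp
  · obtain ⟨h1, h2, h3, h4, h5⟩ := hs
    by_cases hs1 : r ∈ S1.roles
    · have key : ∀ σ', (c1.st r, Act.rcv s r a, σ') ∈ (S1.mach r).delta →
          σ' = (if r = H then proj (c'.st H) else c'.st r) → Sim S1 H c' := by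
        intro σ' hd hσ
        have hr : s ∈ S1.roles := by
          obtain ⟨r', a', e1, e2, e3⟩ := hwf r hs1 _ _ _ hd
          simp at e3
          exact e3.1 ▸ e1
        let c1' : Config R A B := ⟨Function.update c1.st r σ',
          fun p q => if p = s ∧ q = r then c'.buf s r else c1.buf p q⟩
        have hstep : Step S1 c1 (.rcv s r a) c1' := by
          refine ⟨hs1, by simpa [c1'] using hd, ?_, ?_, ?_⟩
          · intro p hp; simp [c1', hp]
          · simp [c1', hb s hr r hs1, h4]
          · intro p q hpq; simp only [c1', if_neg hpq]
        refine ⟨c1', hR.step hstep, ?_, ?_, ?_⟩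
        · intro p hp hpH
          by_cases hps : p = r
          · subst hps; simp [c1', hσ, hpH]
          · simp [c1', hps, h3 p hps, hst p hp hpH]
        · by_cases hps : r = H
          · subst hps; simp [c1', hσ]
          · have : H ≠ r := fun h => hps h.symm
            simp [c1', this, h3 H this, hstH]
        · intro p hp q hq
          by_cases hpq : p = s ∧ q = r
          · obtain ⟨rfl, rfl⟩ := hpq
            simp [c1']
          · simp only [c1', if_neg hpq]; rw [h5 p q hpq, hb p hp q hq]
      by_cases hsH : r = H
      · subst hsH
        rw [hmH] at h2
        rcases h2 with ⟨q, s', b, q', hd, h | h⟩ | ⟨q, s', b, q', hd, h | h⟩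
        · simp only [Prod.mk.injEq, Act.rcv.injEq, true_and] at h
          obtain ⟨e1, ⟨rfl, rfl⟩, e2⟩ := h
          obtain ⟨b, hbq⟩ := (hf.2 _ _ _ hd).1
          refine ⟨c1, hR, ?_, ?_, ?_⟩
          · intro p hp hpH; rw [h3 p hpH, hst p hp hpH]
          · rw [hstH, e1, e2, hbq]; rfl
          · intro p hp q hq
            rw [h5 p q, hb p hp q hq]
            rintro ⟨rfl, -⟩; exact hK hp
        · simp at h
        · simp only [Prod.mk.injEq, Act.rcv.injEq, true_and] at h
          obtain ⟨e1, ⟨rfl, rfl⟩, e2⟩ := h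
          obtain ⟨b, hbq⟩ := (hf.2 _ _ _ hd).1
          refine key q' ?_ ?_
          · rw [hstH, e1, hbq]; rw [hbq] at hd; exact hd
          · rw [if_pos rfl, e2]; rfl
        · simp at h
      · rw [hm r hs1 hsH] at h2
        exact key _ (by rw [hst r hs1 hsH]; exact h2) (by rw [if_neg hsH])
    · refine ⟨c1, hR, ?_, ?_, ?_⟩
      · intro p hp hpH; rw [h3 p, hst p hp hpH]; rintro rfl; exact hs1 hp
      · rw [h3 H, hstH]; rintro rfl; exact hs1 hH
      · intro p hp q hq
        rw [h5 p q, hb p hp q hq]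
        rintro ⟨-, rfl⟩; exact hs1 hq

theorem Sim.init {S S1 : CS R A B} {H K : R} (hH : H ∈ S1.roles)
    (hf : (S1.mach H).HatFree) (hsub : S1.roles ⊆ S.roles)
    (hmH : S.mach H = (S1.mach H).gw H K)
    (hm : ∀ p ∈ S1.roles, p ≠ H → S.mach p = S1.mach p)
    {c} (h : InitConf S c) : Sim S1 H c := by
  obtain ⟨b, hb⟩ := hf.1
  have hcH : c.st H = (S1.mach H).init := by rw [h.1 H (hsub hH), hmH]; rfl
  refine ⟨c, ⟨c, ⟨?_, ?_⟩, .refl⟩, fun _ _ _ => rfl, ?_, fun _ _ _ _ => rfl⟩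
  · intro p hp
    by_cases hpH : p = H
    · rw [hpH, hcH]
    · rw [h.1 p (hsub hp), hm p hp hpH]
  · intro p hp q hq; exact h.2 p (hsub hp) q (hsub hq)
  · rw [hcH, hb]; rfl

theorem Sim.deadlock {S S1 : CS R A B} {H : R} (hsub : S1.roles ⊆ S.roles)
    (hm : ∀ p ∈ S1.roles, p ≠ H → S.mach p = S1.mach p)
    (hdf : DeadlockFree S1) {c b} (h : Sim S1 H c) (hd : DeadlockConf S c)
    (hb : c.st H = .base b) (hr : (S1.mach H).Receiving (c.st H)) : False := by
  obtain ⟨c1, hR, hst, hstH, hbuf⟩ := h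
  refine hdf c1 hR ⟨?_, ?_⟩
  · intro p hp q hq; rw [hbuf p hp q hq]; exact hd.1 p (hsub hp) q (hsub hq)
  · intro p hp
    by_cases hpH : p = H
    · subst hpH
      rw [hstH, hb]; rw [hb] at hr; exact hr
    · rw [hst p hp hpH, ← hm p hp hpH]; exact hd.2 p (hsub hp)

/-- channel invariant -/
def Chan (M N : CFSM R A B) (H K : R) (c : Config R A B) : Prop :=
  ∃ x y x' y', G M (c.st H) x y ∧ G N (c.st K) x' y' ∧
    x = y' ++ c.buf H K ∧ x' = y ++ c.buf K H

theorem Chan.symm {M N : CFSM R A B} {H K : R} {c} (h : Chan M N H K c) : Chan N M K H c := by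
  obtain ⟨x, y, x', y', h1, h2, h3, h4⟩ := h
  exact ⟨x', y', x, y, h2, h1, h4, h3⟩

/-- acting role of an action -/
def Act.actor : Act R A → R
  | .snd s _ _ => s
  | .rcv _ r _ => r

theorem Chan.step {S : CS R A B} {M N : CFSM R A B} {H K : R} {P : Set R} (hHK : H ≠ K)
    (hA : M.ActsFor H P) (hK : K ∉ P) (hf : M.HatFree) (hmH : S.mach H = M.gw H K)
    {c l c'} (h : Chan M N H K c) (hs : Step S c l c') (hl : l.actor ≠ K) :
    Chan M N H K c' := by
  obtain ⟨x, y, x', y', g1, g2, e1, e2⟩ := h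
  rcases l with ⟨s, r, a⟩ | ⟨s, r, a⟩
  · obtain ⟨h1, h2, h3, h4, h5⟩ := hs
    simp only [Act.actor] at hl
    have hKs : c'.st K = c.st K := h3 K hl.symm
    have hbK : c'.buf K H = c.buf K H := h5 _ _ (fun h => hl h.1.symm)
    by_cases hsH : s = H
    · subst hsH
      rw [hmH] at h2
      rcases G_snd hA hK hf g1 h2 with ⟨hr, g⟩ | ⟨rfl, g⟩
      · refine ⟨_, _, _, _, g, hKs ▸ g2, ?_, by rw [hbK, e2]⟩
        rw [h5 _ _ (fun h => hr h.2.symm), e1]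
      · refine ⟨_, _, _, _, g, hKs ▸ g2, ?_, by rw [hbK, e2]⟩
        rw [h4, e1, List.append_assoc]
    · refine ⟨x, y, x', y', ?_, hKs ▸ g2, ?_, by rw [hbK, e2]⟩
      · rw [h3 H (Ne.symm hsH)]; exact g1
      · rw [h5 _ _ (fun h => hsH h.1.symm), e1]
  · obtain ⟨h1, h2, h3, h4, h5⟩ := hs
    simp only [Act.actor] at hl
    have hKs : c'.st K = c.st K := h3 K hl.symm
    have hbK : c'.buf H K = c.buf H K := h5 _ _ (fun h => hl h.2.symm)
    by_cases hsH : r = H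
    · subst hsH
      rw [hmH] at h2
      rcases G_rcv hA hK hf g1 h2 with ⟨hr, g⟩ | ⟨rfl, g⟩
      · refine ⟨_, _, _, _, g, hKs ▸ g2, by rw [hbK, e1], ?_⟩
        rw [h5 _ _ (fun h => hr h.1.symm), e2]
      · refine ⟨_, _, _, _, g, hKs ▸ g2, by rw [hbK, e1], ?_⟩
        rw [e2, h4]; simp
    · refine ⟨x, y, x', y', ?_, hKs ▸ g2, by rw [hbK, e1], ?_⟩
      · rw [h3 H (Ne.symm hsH)]; exact g1
      · rw [h5 _ _ (fun h => hsH h.2.symm), e2]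

end GTIR

/-- preservation of deadlock-freeness under composition. -/
theorem stmt7_deadlock_freeness_preserved
    {R A B : Type} [Finite R] [Finite A]
    (S1 S2 : CS R A B) (H K : R)
    (hH : H ∈ S1.roles) (hK : K ∈ S2.roles)
    (hdisj : S1.roles ∩ S2.roles = ∅)
    (hcompat : (S1.mach H).Compat (S2.mach K))
    (hwf1 : S1.WF) (hwf2 : S2.WF)
    (hfin1 : S1.FiniteSys) (hfin2 : S2.FiniteSys)
    (hhf1 : (S1.mach H).HatFree) (hhf2 : (S2.mach K).HatFree)
    (hdf1 : DeadlockFree S1) (hdf2 : DeadlockFree S2) :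
    DeadlockFree (CS.compose S1 S2 H K) := by
  have hd : ∀ p, p ∈ S1.roles → p ∉ S2.roles := fun p h1 h2 => by
    have : p ∈ S1.roles ∩ S2.roles := ⟨h1, h2⟩
    simp [hdisj] at this
  have hHK : H ≠ K := fun h => hd _ hH (h ▸ hK)
  have hK1 : K ∉ S1.roles := fun h => hd _ h hK
  have hH2 : H ∉ S2.roles := hd _ hH
  have sub1 : S1.roles ⊆ (CS.compose S1 S2 H K).roles := fun p hp => Or.inl hp
  have sub2 : S2.roles ⊆ (CS.compose S1 S2 H K).roles := fun p hp => Or.inr hp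
  have mH : (CS.compose S1 S2 H K).mach H = (S1.mach H).gw H K := by simp [CS.compose]
  have mK : (CS.compose S1 S2 H K).mach K = (S2.mach K).gw K H := by
    simp [CS.compose, hHK.symm]
  have m1 : ∀ p ∈ S1.roles, p ≠ H → (CS.compose S1 S2 H K).mach p = S1.mach p := by
    intro p hp hpH
    have : p ≠ K := fun h => hK1 (h ▸ hp)
    simp [CS.compose, hpH, this, hp]
  have m2 : ∀ p ∈ S2.roles, p ≠ K → (CS.compose S1 S2 H K).mach p = S2.mach p := by
    intro p hp hpK
    have h1 : p ≠ H := fun h => hH2 (h ▸ hp)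
    have h2 : p ∉ S1.roles := fun h => hd _ h hp
    simp [CS.compose, hpK, h1, h2]
  generalize CS.compose S1 S2 H K = S at *
  obtain ⟨hL, hn1, hn2, hi1, hi2⟩ := hcompat
  intro c hc hdead
  obtain ⟨c0, hinit, hr⟩ := hc
  have inv : Sim S1 H c ∧ Sim S2 K c ∧ Chan (S1.mach H) (S2.mach K) H K c := by
    clear hdead
    induction hr with
    | refl =>
      refine ⟨Sim.init hH hhf1 sub1 mH m1 hinit, Sim.init hK hhf2 sub2 mK m2 hinit, ?_⟩
      refine ⟨[], [], [], [], ?_, ?_, ?_, ?_⟩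
      · have := hinit.1 H (sub1 hH)
        rw [this, mH]; exact .stay (.nil _)
      · have := hinit.1 K (sub2 hK)
        rw [this, mK]; exact .stay (.nil _)
      · rw [hinit.2 _ (sub1 hH) _ (sub2 hK)]; rfl
      · rw [hinit.2 _ (sub2 hK) _ (sub1 hH)]; rfl
    | tail _ hs ih =>
      obtain ⟨l, hs⟩ := hs
      obtain ⟨i1, i2, i3⟩ := ih
      refine ⟨i1.step hH hK1 hwf1 hhf1 mH m1 hs, i2.step hK hH2 hwf2 hhf2 mK m2 hs, ?_⟩
      by_cases hl : l.actor = K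
      · exact (i3.symm.step hHK.symm (hwf2 K hK) hH2 hhf2 mK hs
          (fun h => hHK (h.symm.trans hl))).symm
      · exact i3.step hHK (hwf1 H hH) hK1 hhf1 mH hs hl
  obtain ⟨s1, s2, x, y, x', y', g1, g2, e1, e2⟩ := inv
  have r1 := hdead.2 H (sub1 hH)
  have r2 := hdead.2 K (sub2 hK)
  rw [mH] at r1
  rw [mK] at r2
  obtain ⟨w, b, p1, rfl, rfl, hb, l, q', hl⟩ := G_receiving (hwf1 H hH) hhf1 g1 r1
  obtain ⟨v, b', p2, rfl, rfl, hb', -⟩ := G_receiving (hwf2 K hK) hhf2 g2 r2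
  rw [hdead.1 _ (sub1 hH) _ (sub2 hK), List.append_nil] at e1
  rw [hdead.1 _ (sub2 hK) _ (sub1 hH), List.append_nil] at e2
  have D := (DR.init hL).path hi1 hi2 hn2 p1 p2 e1 e2.symm
  have recv : ∀ (M : CFSM R A B), M.NoMixed → ∀ q s r a q', (q, Act.rcv s r a, q') ∈ M.delta →
      M.Receiving q := by
    intro M hM q s r a q' h
    refine ⟨⟨_, _, h⟩, ?_⟩
    rintro (⟨s', r', a'⟩ | ⟨s', r', a'⟩) q'' h'
    · exact absurd ⟨⟨_, _, h', trivial⟩, ⟨_, _, h, trivial⟩⟩ (hM q)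
    · trivial
  rcases l with ⟨s, r, a⟩ | ⟨s, r, a⟩
  · obtain ⟨m, k', hm, en⟩ := D.next hl
    rcases m with ⟨s', r', a'⟩ | ⟨s', r', a'⟩
    · simp [Act.noC, Pol.dual] at en
    · exact s2.deadlock sub2 m2 hdf2 hdead hb' (recv _ hn2 _ _ _ _ _ hm)
  · exact s1.deadlock sub1 m1 hdf1 hdead hb (recv _ hn1 _ _ _ _ _ hl)
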